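/- (Decomposition Lemma) Let (I,J) be an instance of Variable-Sized Bin Covering with unit supply such that NFD's solution has k well-covered bins and at least one non-empty bin that is not well-covered; let i* be the head of the instance. Let J' be the set of items NFD assigns to the bins 1,…,i*, let J'' = J ∖ J', let I' = {1,…,i*} and I'' = I ∖ I'. If NFD(I,J) > 0 and NFD(I'',J'') > 0, then OPT(I,J)/NFD(I,J) ≤ max{ 9/4, OPT(I'',J'')/NFD(I'',J'') }. -/

import Mathlib

open scoped Classical

noncomputable section

namespace BinCov

/-- Profit of a solution `S` on the bin set `B`: a bin `i ∈ B` earns profit `p i`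
if the total size of the items assigned to it is at least its demand `d i`. -/
def profit (d p s : ℕ → ℝ) (B : Finset ℕ) (S : ℕ → Finset ℕ) : ℝ :=
  ∑ i ∈ B, if d i ≤ ∑ j ∈ S i, s j then p i else 0

/-- A solution assigns pairwise disjoint subsets of the item set `T` to the bins. -/
def IsSolution (T : Finset ℕ) (S : ℕ → Finset ℕ) : Prop :=
  (∀ i, S i ⊆ T) ∧ Pairwise fun i i' => Disjoint (S i) (S i')

/-- Optimal profit over all solutions on bins `B` and items `T`. -/
def OPT (d p s : ℕ → ℝ) (B T : Finset ℕ) : ℝ :=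
  sSup (profit d p s B '' {S | IsSolution T S})

/-- Take a minimal prefix of `items` whose total size reaches `dem`;
returns this prefix together with the remaining items. -/
def takeFill (s : ℕ → ℝ) : ℝ → List ℕ → List ℕ × List ℕ
  | _, [] => ([], [])
  | dem, j :: rest =>
    if dem ≤ s j then ([j], rest)
    else
      let q := takeFill s (dem - s j) rest
      (j :: q.1, q.2)

/-- Next Fit Decreasing on the list `bins` of bins and the list `items` of still
unassigned items (both by index, i.e. in non-increasing order of demand resp. size):
if the unassigned items cannot cover the current bin, it is left empty; otherwise a
minimal prefix of the unassigned items is assigned to it.  Returns, for each bin,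
the set of items assigned to it. -/
def nfdAux (d s : ℕ → ℝ) : List ℕ → List ℕ → ℕ → Finset ℕ
  | [], _, _ => ∅
  | i :: bins, items, b =>
    if d i ≤ (items.map s).sum then
      let q := takeFill s (d i) items
      if b = i then q.1.toFinset else nfdAux d s bins q.2 b
    else
      if b = i then ∅ else nfdAux d s bins items b

/-- The solution produced by NFD on bin set `B` and item set `T` (bins and items are
processed in increasing order of index; demands and sizes are non-increasing in the index). -/
def nfdSol (d s : ℕ → ℝ) (B T : Finset ℕ) : ℕ → Finset ℕ :=
  nfdAux d s (B.sort (· ≤ ·)) (T.sort (· ≤ ·))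

/-- The total size `u i` that NFD assigns to bin `i`. -/
def nfdU (d s : ℕ → ℝ) (B T : Finset ℕ) (i : ℕ) : ℝ :=
  ∑ j ∈ nfdSol d s B T i, s j

/-- The profit NFD earns (Variable-Sized Bin Covering: the profit of a bin is its demand). -/
def NFD (d s : ℕ → ℝ) (B T : Finset ℕ) : ℝ :=
  profit d d s B (nfdSol d s B T)

/-- A bin `istar` with `u istar > 0` in NFD's solution (bins `0,…,m-1`, items `T`) is
well-covered if for the smallest index `i' > istar` with `u i' = 0` (which must exist)
one has `u i ≤ 2 * d i` for all bins `i ≤ i'`. -/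
def WellCovered (d s : ℕ → ℝ) (m : ℕ) (T : Finset ℕ) (istar : ℕ) : Prop :=
  istar < m ∧ 0 < nfdU d s (Finset.range m) T istar ∧
    ∃ i', istar < i' ∧ i' < m ∧ nfdU d s (Finset.range m) T i' = 0 ∧
      (∀ i, istar < i → i < i' → nfdU d s (Finset.range m) T i ≠ 0) ∧
      ∀ i ≤ i', nfdU d s (Finset.range m) T i ≤ 2 * d i

/-- `istar` is the head of the instance: letting `i0` be the smallest index of a non-empty
bin of NFD's solution that is not well-covered, and `i1 ≥ i0` the smallest index with
`u (i1+1) = 0`, the head is the largest index `istar ≤ i1` with `u istar > 2 * d istar`. -/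
def IsHead (d s : ℕ → ℝ) (m : ℕ) (T : Finset ℕ) (istar : ℕ) : Prop :=
  ∃ i0 i1,
    i0 < m ∧ 0 < nfdU d s (Finset.range m) T i0 ∧ ¬ WellCovered d s m T i0 ∧
    (∀ i < i0, 0 < nfdU d s (Finset.range m) T i → WellCovered d s m T i) ∧
    i0 ≤ i1 ∧ nfdU d s (Finset.range m) T (i1 + 1) = 0 ∧
    (∀ i, i0 ≤ i → i < i1 → nfdU d s (Finset.range m) T (i + 1) ≠ 0) ∧
    istar ≤ i1 ∧ 2 * d istar < nfdU d s (Finset.range m) T istar ∧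
    (∀ i ≤ i1, 2 * d i < nfdU d s (Finset.range m) T i → i ≤ istar)

/-- The inner loop of `ALG*` on one bin: `dcap` is the bin's demand (items are admissible iff
their size is at most `dcap`), `space` is the part of the demand not yet covered, and `rem j`
is the still unassigned part of item `j` (items `0,…,n-1`, sizes non-increasing in the index).
While the bin is not covered and some admissible item is not fully assigned, the largest such
item (i.e. the one of smallest index) is taken and its remaining part is assigned to the bin,
splitting it so that the bin is exactly covered if it would overflow.
Returns the updated remainders together with the total amount assigned to the bin. -/
def fillBin (s : ℕ → ℝ) (n : ℕ) (dcap : ℝ) : ℕ → ℝ → (ℕ → ℝ) → (ℕ → ℝ) × ℝ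
  | 0, _, rem => (rem, 0)
  | fuel + 1, space, rem =>
    if h : ∃ j, j < n ∧ s j ≤ dcap ∧ 0 < rem j then
      let j := Nat.find h
      if rem j ≤ space then
        let q := fillBin s n dcap fuel (space - rem j) (Function.update rem j 0)
        (q.1, q.2 + rem j)
      else
        (Function.update rem j (rem j - space), space)
    else (rem, 0)

/-- The outer loop of `ALG*`: the bins are processed in the given order (non-increasing
efficiency); returns the total amount assigned to each bin. -/
def algStarFillAux (d s : ℕ → ℝ) (n : ℕ) : List ℕ → (ℕ → ℝ) → ℕ → ℝ
  | [], _, _ => 0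
  | i :: bins, rem, b =>
    let q := fillBin s n (d i) n (d i) rem
    if b = i then q.2 else algStarFillAux d s n bins q.1 b

/-- The total amount `ALG*` assigns to each bin, on the instance with bins `0,…,m-1`
(in non-increasing order of efficiency) and items `0,…,n-1` (in non-increasing order of size). -/
def algStarFill (m n : ℕ) (d s : ℕ → ℝ) : ℕ → ℝ :=
  algStarFillAux d s n (List.range m) fun j => if j < n then s j else 0

/-- The modified profit `p*` of the solution produced by `ALG*`. -/
def algStarPStar (m n : ℕ) (d p s : ℕ → ℝ) : ℝ :=
  ∑ i ∈ Finset.range m, p i * min (algStarFill m n d s i / d i) 1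

/-- The optimum of the linear program for the modified Bin Covering problem. -/
def LPOpt (m n : ℕ) (d p s : ℕ → ℝ) : ℝ :=
  sSup {v : ℝ | ∃ y : ℕ → ℝ, ∃ x : ℕ → ℕ → ℝ,
    (∀ i < m, y i ≤ (∑ j ∈ Finset.range n, x j i) / d i) ∧
    (∀ j < n, ∑ i ∈ Finset.range m, x j i ≤ s j) ∧
    (∀ i, 0 ≤ y i ∧ y i ≤ 1) ∧
    (∀ j i, 0 ≤ x j i) ∧
    (∀ j < n, ∀ i < m, d i < s j → x j i = 0) ∧
    v = ∑ i ∈ Finset.range m, p i * y i}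

/-- A solution of the modified Bin Covering problem, assigning item parts from the
finite set `P` (part `q ∈ P` belongs to item `itm q`) to the bins `0,…,m-1`;
a part may only be assigned to a bin to which its item is admissible. -/
def IsPartSolution (m : ℕ) (d s : ℕ → ℝ) (itm : ℕ → ℕ) (P : Finset ℕ) (S : ℕ → Finset ℕ) : Prop :=
  (∀ i, S i ⊆ P) ∧ (Pairwise fun i i' => Disjoint (S i) (S i')) ∧
  (∀ i < m, ∀ q ∈ S i, s (itm q) ≤ d i) ∧ (∀ i, m ≤ i → S i = ∅)

/-- The modified profit `p*` of a solution, where `psz q` is the size of part `q`. -/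
def pStarParts (m : ℕ) (d p psz : ℕ → ℝ) (S : ℕ → Finset ℕ) : ℝ :=
  ∑ i ∈ Finset.range m, p i * min ((∑ q ∈ S i, psz q) / d i) 1

/-- A solution of the modified Bin Covering problem is maximal if there are no two distinct
bins `i`, `i'` with `0 < s(S_i) < d_i`, `0 < s(S_i') < d_i'` and `e_i ≤ e_i'` such that
some item of `S_i` is admissible to bin `i'`. -/
def MaximalMod (m : ℕ) (d p s : ℕ → ℝ) (S : ℕ → Finset ℕ) : Prop :=
  ¬ ∃ i i', i < m ∧ i' < m ∧ i ≠ i' ∧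
      (0 < ∑ j ∈ S i, s j) ∧ (∑ j ∈ S i, s j) < d i ∧
      (0 < ∑ j ∈ S i', s j) ∧ (∑ j ∈ S i', s j) < d i' ∧
      p i / d i ≤ p i' / d i' ∧ ∃ j ∈ S i, s j ≤ d i'

/-- A solution induced by a matching in the bipartite graph on bins and items with an
edge `ij` whenever `s j > d i`: every bin receives at most one item, and any item
assigned to a bin covers it singularly. -/
def IsMatchingSol (m n : ℕ) (d s : ℕ → ℝ) (S : ℕ → Finset ℕ) : Prop :=
  IsSolution (Finset.range n) S ∧ (∀ i, (S i).card ≤ 1) ∧ ∀ i < m, ∀ j ∈ S i, d i < s j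

end BinCov

namespace BinCov

/-! ### Next Fit Decreasing as a sequence of pointers -/

theorem takeFill_append (s : ℕ → ℝ) (items : List ℕ) (dem : ℝ) :
    (takeFill s dem items).1 ++ (takeFill s dem items).2 = items := by
  induction items generalizing dem with
  | nil => rfl
  | cons j rest ih =>
    by_cases h : dem ≤ s j
    · simp [takeFill, h]
    · simp [takeFill, h, ih]

theorem takeFill_spec (s : ℕ → ℝ) (items : List ℕ) (dem : ℝ) (hdem : 0 < dem)
    (h : dem ≤ (items.map s).sum) :
    ∃ l j, (takeFill s dem items).1 = l ++ [j] ∧ (l.map s).sum < dem ∧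
      dem ≤ (l.map s).sum + s j := by
  induction items generalizing dem with
  | nil => simp at h; linarith
  | cons j rest ih =>
    by_cases hj : dem ≤ s j
    · exact ⟨[], j, by simp [takeFill, hj], by simpa using hdem, by simpa using hj⟩
    · push Not at hj
      simp only [List.map_cons, List.sum_cons] at h
      obtain ⟨l, j', h1, h2, h3⟩ := ih (dem - s j) (by linarith) (by linarith)
      refine ⟨j :: l, j', by simp [takeFill, not_le.mpr hj, h1], ?_, ?_⟩ <;>
        simp only [List.map_cons, List.sum_cons] <;> linarith

/-- The number of items `0,…,n-1` which NFD has assigned before it processes bin `i`. -/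
def nfdPtr (d s : ℕ → ℝ) (n : ℕ) : ℕ → ℕ
  | 0 => 0
  | i + 1 =>
    let items := List.range' (nfdPtr d s n i) (n - nfdPtr d s n i)
    if d i ≤ (items.map s).sum then
      nfdPtr d s n i + (takeFill s (d i) items).1.length
    else nfdPtr d s n i

theorem sum_map_range' (s : ℕ → ℝ) (a k : ℕ) :
    ((List.range' a k).map s).sum = ∑ j ∈ Finset.Ico a (a + k), s j := by
  induction k with
  | zero => simp
  | succ k ih =>
    rw [List.range'_concat, List.map_append, List.sum_append, ih, ← Nat.add_assoc,
      Finset.sum_Ico_succ_top (by omega)]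
    simp

theorem toFinset_range' (a k : ℕ) : (List.range' a k).toFinset = Finset.Ico a (a + k) := by
  ext x; simp

theorem eq_range'_of_append {l₁ l₂ : List ℕ} {a k : ℕ} (h : l₁ ++ l₂ = List.range' a k) :
    l₁.length ≤ k ∧ l₁ = List.range' a l₁.length ∧
      l₂ = List.range' (a + l₁.length) (k - l₁.length) := by
  have hlen : l₁.length + l₂.length = k := by
    have := congrArg List.length h
    simpa using this
  have hk : List.range' a k = List.range' a l₁.length ++
      List.range' (a + l₁.length) (k - l₁.length) := by
    have := @List.range'_append a l₁.length (k - l₁.length) 1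
    rw [Nat.one_mul] at this
    rw [this]
    congr 1; omega
  rw [hk] at h
  have := List.append_inj h (by simp)
  exact ⟨by omega, this⟩

theorem nfdPtr_step (d s : ℕ → ℝ) (n i : ℕ) (hdi : 0 < d i) (hc : nfdPtr d s n i ≤ n) :
    (∑ j ∈ Finset.Ico (nfdPtr d s n i) n, s j < d i ∧ nfdPtr d s n (i + 1) = nfdPtr d s n i) ∨
    (nfdPtr d s n i < nfdPtr d s n (i + 1) ∧ nfdPtr d s n (i + 1) ≤ n ∧
      d i ≤ ∑ j ∈ Finset.Ico (nfdPtr d s n i) (nfdPtr d s n (i + 1)), s j ∧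
      ∑ j ∈ Finset.Ico (nfdPtr d s n i) (nfdPtr d s n (i + 1) - 1), s j < d i) := by
  set c := nfdPtr d s n i with hcdef
  have hstep : nfdPtr d s n (i + 1) = if d i ≤ ((List.range' c (n - c)).map s).sum then
      c + (takeFill s (d i) (List.range' c (n - c))).1.length else c := by
    simp [nfdPtr, hcdef]
  have hsum : ((List.range' c (n - c)).map s).sum = ∑ j ∈ Finset.Ico c n, s j := by
    rw [sum_map_range']; congr 2; omega
  by_cases h : d i ≤ ((List.range' c (n - c)).map s).sum
  · right
    rw [if_pos h] at hstep
    obtain ⟨l, j, h1, h2, h3⟩ := takeFill_spec s _ _ hdi h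
    obtain ⟨hle, heq, -⟩ := eq_range'_of_append (takeFill_append s (List.range' c (n - c)) (d i))
    rw [h1] at hle heq
    rw [hstep, h1]
    simp only [List.length_append, List.length_singleton] at hle heq ⊢
    have hl : l = List.range' c l.length ∧ j = c + l.length := by
      rw [List.range'_concat] at heq
      have := List.append_inj heq (by simp)
      simpa using this
    have e1 : (l.map s).sum = ∑ j ∈ Finset.Ico c (c + l.length), s j := by
      rw [← sum_map_range', ← hl.1]
    have e2 : c + (l.length + 1) - 1 = c + l.length := by omega
    refine ⟨by omega, by omega, ?_, ?_⟩
    · rw [← Nat.add_assoc, Finset.sum_Ico_succ_top (by omega), ← e1, ← hl.2]; exact h3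
    · rw [e2, ← e1]; exact h2
  · left
    rw [if_neg h] at hstep
    exact ⟨by rw [← hsum]; exact not_le.mp h, hstep⟩

theorem nfdPtr_le (d s : ℕ → ℝ) (n m : ℕ) (hd : ∀ i < m, 0 < d i) :
    ∀ i ≤ m, nfdPtr d s n i ≤ n := by
  intro i
  induction i with
  | zero => intro _; simp [nfdPtr]
  | succ i ih =>
    intro hi
    have := ih (by omega)
    rcases nfdPtr_step d s n i (hd i (by omega)) this with h | h <;> omega

theorem nfdAux_range' (d s : ℕ → ℝ) (n k b i : ℕ) (hi : b ≤ i) :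
    nfdAux d s (List.range' b k) (List.range' (nfdPtr d s n b) (n - nfdPtr d s n b)) i =
      if i < b + k then Finset.Ico (nfdPtr d s n i) (nfdPtr d s n (i + 1)) else ∅ := by
  induction k generalizing b with
  | zero => simp [nfdAux, not_lt.mpr hi]
  | succ k ih =>
    rw [List.range'_succ]
    have hstep : nfdPtr d s n (b + 1) =
        if d b ≤ ((List.range' (nfdPtr d s n b) (n - nfdPtr d s n b)).map s).sum then
      nfdPtr d s n b + (takeFill s (d b)
        (List.range' (nfdPtr d s n b) (n - nfdPtr d s n b))).1.length else nfdPtr d s n b := by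
      simp [nfdPtr]
    obtain ⟨hle, heq1, heq2⟩ := eq_range'_of_append
      (takeFill_append s (List.range' (nfdPtr d s n b) (n - nfdPtr d s n b)) (d b))
    simp only [nfdAux]
    by_cases h : d b ≤ ((List.range' (nfdPtr d s n b) (n - nfdPtr d s n b)).map s).sum
    · rw [if_pos h] at hstep ⊢
      by_cases hib : i = b
      · subst hib
        rw [if_pos rfl, if_pos (by omega), hstep, heq1, toFinset_range']
        simp
      · rw [if_neg hib, heq2, Nat.sub_sub, ← hstep, ih (b + 1) (by omega)]
        congr 1
        exact propext (by omega)
    · rw [if_neg h] at hstep ⊢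
      by_cases hib : i = b
      · subst hib
        rw [if_pos rfl, if_pos (by omega), hstep]
        simp
      · rw [if_neg hib]
        have := ih (b + 1) (by omega)
        rw [hstep] at this
        rw [this]
        congr 1
        exact propext (by omega)

theorem sort_Ico (a b : ℕ) : (Finset.Ico a b).sort (· ≤ ·) = List.range' a (b - a) := by
  refine List.Perm.eq_of_pairwise' (r := (· ≤ ·)) (Finset.pairwise_sort _ _) ?_ ?_
  · exact List.pairwise_le_range'
  · rw [List.perm_ext_iff_of_nodup (Finset.sort_nodup _ _) List.nodup_range']
    intro x
    simp only [Finset.mem_sort, Finset.mem_Ico, List.mem_range'_1]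
    omega

theorem nfdSol_Ico (d s : ℕ → ℝ) (m n b i : ℕ) (hbm : b ≤ m) (hi : b ≤ i) :
    nfdSol d s (Finset.Ico b m) (Finset.Ico (nfdPtr d s n b) n) i =
      if i < m then Finset.Ico (nfdPtr d s n i) (nfdPtr d s n (i + 1)) else ∅ := by
  rw [nfdSol, sort_Ico, sort_Ico, nfdAux_range' d s n (m - b) b i hi]
  congr 1
  exact propext (by omega)

theorem nfdSol_range (d s : ℕ → ℝ) (m n i : ℕ) :
    nfdSol d s (Finset.range m) (Finset.range n) i =
      if i < m then Finset.Ico (nfdPtr d s n i) (nfdPtr d s n (i + 1)) else ∅ := by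
  have := nfdSol_Ico d s m n 0 i (by omega) (by omega)
  simpa [nfdPtr] using this

/-! ### Charging and summation lemmas -/

theorem sum_le_sum_of_charge {T K : Finset ℕ} {S : ℕ → Finset ℕ} {g v : ℕ → ℝ}
    (hS : Pairwise fun i i' => Disjoint (S i) (S i')) (hv : ∀ j ∈ T, 0 ≤ v j)
    (h : ∀ i ∈ K, ∃ j ∈ S i, j ∈ T ∧ g i ≤ v j) : ∑ i ∈ K, g i ≤ ∑ j ∈ T, v j := by
  choose! f hf using h
  have hinj : Set.InjOn f K := by
    intro i hi i' hi' hii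
    by_contra hne
    exact Finset.disjoint_left.mp (hS hne) (hf i hi).1 (hii ▸ (hf i' hi').1)
  calc ∑ i ∈ K, g i ≤ ∑ i ∈ K, v (f i) := Finset.sum_le_sum fun i hi => (hf i hi).2.2
    _ = ∑ j ∈ K.image f, v j := (Finset.sum_image hinj).symm
    _ ≤ ∑ j ∈ T, v j := Finset.sum_le_sum_of_subset_of_nonneg
        (fun j hj => by
          obtain ⟨i, hi, rfl⟩ := Finset.mem_image.mp hj
          exact (hf i hi).2.1)
        (fun j hj _ => hv j hj)

theorem card_le_card_of_charge {T K : Finset ℕ} {S : ℕ → Finset ℕ}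
    (hS : Pairwise fun i i' => Disjoint (S i) (S i'))
    (h : ∀ i ∈ K, ∃ j ∈ S i, j ∈ T) : K.card ≤ T.card := by
  have := sum_le_sum_of_charge (T := T) (K := K) (g := fun _ => 1) (v := fun _ => 1) hS
    (fun _ _ => zero_le_one) (fun i hi => by
      obtain ⟨j, h1, h2⟩ := h i hi
      exact ⟨j, h1, h2, le_rfl⟩)
  simpa using this

theorem abel_le_sum (w d : ℕ → ℝ) (l : ℕ) (hd : ∀ i < l, d (i + 1) ≤ d i)
    (hw : ∀ i ≤ l, 0 ≤ ∑ j ∈ Finset.range i, w j) :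
    (∑ j ∈ Finset.range (l + 1), w j) * d l ≤ ∑ j ∈ Finset.range (l + 1), w j * d j := by
  induction l with
  | zero => simp
  | succ l ih =>
    have h1 := ih (fun i hi => hd i (by omega)) (fun i hi => hw i (by omega))
    have h2 := mul_le_mul_of_nonneg_left (hd l (by omega)) (hw (l + 1) le_rfl)
    rw [Finset.sum_range_succ, Finset.sum_range_succ _ (l + 1), add_mul]
    linarith

theorem sum_range_ptr (s : ℕ → ℝ) (c : ℕ → ℕ) (a b : ℕ) (hab : a ≤ b)
    (hc : ∀ i, a ≤ i → i < b → c i ≤ c (i + 1)) :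
    c a ≤ c b ∧ ∑ j ∈ Finset.Ico (c a) (c b), s j =
      ∑ i ∈ Finset.Ico a b, ∑ j ∈ Finset.Ico (c i) (c (i + 1)), s j := by
  induction b, hab using Nat.le_induction with
  | base => simp
  | succ b hab ih =>
    obtain ⟨h1, h2⟩ := ih fun i hi hib => hc i hi (by omega)
    have h3 := hc b hab (by omega)
    refine ⟨h1.trans h3, ?_⟩
    rw [Finset.sum_Ico_succ_top hab, ← h2, Finset.sum_Ico_consecutive _ h1 h3]

theorem sum_union_le {A B : Finset ℕ} {d : ℕ → ℝ} (hA : ∀ i ∈ A, 0 ≤ d i) :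
    ∑ i ∈ A ∪ B, d i ≤ ∑ i ∈ A, d i + ∑ i ∈ B, d i := by
  rw [← Finset.sum_union_inter]
  exact le_add_of_nonneg_right
    (Finset.sum_nonneg fun i hi => hA i (Finset.mem_inter.mp hi).1)

theorem sum_sum_le_of_isSolution {T K : Finset ℕ} {S : ℕ → Finset ℕ} {s : ℕ → ℝ}
    (hS : IsSolution T S) (hs : ∀ j ∈ T, 0 ≤ s j) :
    ∑ i ∈ K, ∑ j ∈ S i, s j ≤ ∑ j ∈ T, s j := by
  rw [← Finset.sum_biUnion (fun i _ i' _ h => hS.2 h)]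
  refine Finset.sum_le_sum_of_subset_of_nonneg ?_ fun j hj _ => hs j hj
  exact Finset.biUnion_subset.mpr fun i _ => hS.1 i

/-- The pointers `c` describe a run of Next Fit Decreasing on bins `0,…,m-1` and items
`0,…,n-1`. -/
def IsNFDRun (d s : ℕ → ℝ) (m n : ℕ) (c : ℕ → ℕ) : Prop :=
  ∀ i < m, (∑ j ∈ Finset.Ico (c i) n, s j < d i ∧ c (i + 1) = c i) ∨
    (c i < c (i + 1) ∧ c (i + 1) ≤ n ∧
      d i ≤ ∑ j ∈ Finset.Ico (c i) (c (i + 1)), s j ∧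
      ∑ j ∈ Finset.Ico (c i) (c (i + 1) - 1), s j < d i)

theorem IsNFDRun.le_succ {d s : ℕ → ℝ} {m n : ℕ} {c : ℕ → ℕ} (hF : IsNFDRun d s m n c)
    {i : ℕ} (hi : i < m) : c i ≤ c (i + 1) := by
  rcases hF i hi with h | h <;> omega

theorem IsNFDRun.mono {d s : ℕ → ℝ} {m n : ℕ} {c : ℕ → ℕ} (hF : IsNFDRun d s m n c)
    {a b : ℕ} (hab : a ≤ b) (hb : b ≤ m) : c a ≤ c b :=
  (sum_range_ptr (fun _ => 0) c a b hab fun _ _ _ => hF.le_succ (by omega)).1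

theorem IsNFDRun.eq_succ_or_lt {d s : ℕ → ℝ} {m n : ℕ} {c : ℕ → ℕ} (hF : IsNFDRun d s m n c)
    (hs : ∀ j < n, 0 < s j) (hsm : ∀ j j', j ≤ j' → j' < n → s j' ≤ s j)
    {i : ℕ} (hi : i < m) (hne : c i < c (i + 1)) :
    c (i + 1) = c i + 1 ∨ ∑ j ∈ Finset.Ico (c i) (c (i + 1)), s j < 2 * d i := by
  rcases hF i hi with h | ⟨-, hn, -, h⟩
  · omega
  · by_cases h1 : c (i + 1) = c i + 1
    · exact Or.inl h1
    · right
      obtain ⟨l, hl⟩ : ∃ l, c (i + 1) = l + 1 := ⟨c (i + 1) - 1, by omega⟩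
      rw [hl] at h hn ⊢
      rw [Finset.sum_Ico_succ_top (by omega)]
      have h2 : s (c i) ≤ ∑ j ∈ Finset.Ico (c i) l, s j :=
        Finset.single_le_sum (f := s) (fun j hj => (hs j (by simp at hj; omega)).le)
          (by simp; omega)
      have h3 := hsm (c i) l (by omega) (by omega)
      simp only [Nat.add_sub_cancel] at h
      linarith

theorem IsNFDRun.sum_le_of_three_le {d s : ℕ → ℝ} {m n : ℕ} {c : ℕ → ℕ}
    (hF : IsNFDRun d s m n c)
    (hs : ∀ j < n, 0 < s j) (hsm : ∀ j j', j ≤ j' → j' < n → s j' ≤ s j)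
    {i : ℕ} (hi : i < m) (hne : c i + 3 ≤ c (i + 1)) :
    ∑ j ∈ Finset.Ico (c i) (c (i + 1)), s j ≤ 3 / 2 * d i := by
  rcases hF i hi with h | ⟨-, hn, -, h⟩
  · omega
  · obtain ⟨l, hl⟩ : ∃ l, c (i + 1) = l + 1 := ⟨c (i + 1) - 1, by omega⟩
    rw [hl] at h hn ⊢
    rw [Finset.sum_Ico_succ_top (by omega)]
    have h2 : ∑ j ∈ Finset.Ico (c i) (c i + 2), s j ≤ ∑ j ∈ Finset.Ico (c i) l, s j :=
      Finset.sum_le_sum_of_subset_of_nonneg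
        (Finset.Ico_subset_Ico_right (by omega))
        (fun j hj _ => (hs j (by simp at hj; omega)).le)
    rw [Finset.sum_Ico_succ_top (by omega), Finset.sum_Ico_succ_top (by omega)] at h2
    simp only [Finset.Ico_self, Finset.sum_empty] at h2
    have h3 := hsm (c i) l (by omega) (by omega)
    have h4 := hsm (c i + 1) l (by omega) (by omega)
    simp only [Nat.add_sub_cancel] at h
    linarith

/-- A bin which is covered by a solution but left empty by NFD, or precedes such a bin, holds an
item that NFD assigned before. -/
theorem exists_mem_lt_ptr {d s : ℕ → ℝ} {n : ℕ} {S : ℕ → Finset ℕ} {c e i : ℕ}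
    (hs : ∀ j < n, 0 < s j) (hS : IsSolution (Finset.range n) S)
    (hrest : ∑ j ∈ Finset.Ico c n, s j < d e) (hde : d e ≤ d i)
    (hi : d i ≤ ∑ j ∈ S i, s j) : ∃ j ∈ S i, j ∈ Finset.range c := by
  by_contra! hcon
  have : ∑ j ∈ S i, s j ≤ ∑ j ∈ Finset.Ico c n, s j :=
    Finset.sum_le_sum_of_subset_of_nonneg
      (fun j hj => by
        have h1 := hcon j hj
        have h2 := hS.1 i hj
        simp at h1 h2 ⊢
        omega)
      (fun j hj _ => (hs j (by simp at hj; omega)).le)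
  linarith

section Core

variable {d s : ℕ → ℝ} {m n : ℕ} {c : ℕ → ℕ} {S : ℕ → Finset ℕ}

/-- The profit earned by bins up to an empty bin `e`, or by using items assigned before it,
when NFD assigns at most two items to each of the preceding bins. -/
theorem profit_le_of_le_two {e : ℕ} {C₁ C₃ : Finset ℕ}
    (hdm : ∀ i i', i ≤ i' → i' < m → d i' ≤ d i)
    (hs : ∀ j < n, 0 < s j)
    (hF : IsNFDRun d s m n c) (hc0 : c 0 = 0) (hS : IsSolution (Finset.range n) S)
    (he : e < m) (hce : c (e + 1) = c e)
    (hC₁ : ∀ i ∈ C₁, i ≤ e ∧ d i ≤ ∑ j ∈ S i, s j)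
    (hC₃ : ∀ i ∈ C₃, e < i ∧ i < m ∧ ∃ j ∈ S i, j ∈ Finset.range (c (e + 1)))
    (ht : ∀ i ≤ e, c (i + 1) ≤ c i + 2) (hde : 0 < d e) :
    ∑ i ∈ C₁, d i + ∑ i ∈ C₃, d i ≤
      2 * ∑ i ∈ Finset.range (e + 1) with c i < c (i + 1), d i := by
  have hrest : ∀ i ≤ e, c (i + 1) = c i → ∑ j ∈ Finset.Ico (c i) n, s j < d i := by
    intro i hi h
    rcases hF i (by omega) with h' | h'
    · exact h'.1
    · omega
  set χ : ℕ → ℝ := fun i => if c i < c (i + 1) then 1 else 0 with hχ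
  set ψ : ℕ → ℝ := fun i => if i ∈ C₁ then 1 else 0 with hψ
  have hχc : ∀ l ≤ e + 1, (c l : ℝ) ≤ 2 * ∑ i ∈ Finset.range l, χ i := by
    intro l
    induction l with
    | zero => simp [hc0]
    | succ l ih =>
      intro hl
      have h1 := ih (by omega)
      have h2 := ht l (by omega)
      rw [Finset.sum_range_succ]
      by_cases h : c l < c (l + 1)
      · have : χ l = 1 := if_pos h
        rw [this]
        have : (c (l + 1) : ℝ) ≤ c l + 2 := by exact_mod_cast h2
        linarith
      · have : χ l = 0 := if_neg h
        rw [this]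
        have : (c (l + 1) : ℝ) ≤ c l := by exact_mod_cast not_lt.mp h
        linarith
  have hψsum : ∀ l, ∑ i ∈ Finset.range l, ψ i = ((C₁.filter (· < l)).card : ℝ) := by
    intro l
    rw [hψ, Finset.sum_ite_mem, Finset.sum_const, nsmul_eq_mul, mul_one]
    congr 2
    ext x; simp [and_comm]
  have hw : ∀ l ≤ e + 1, 0 ≤ ∑ i ∈ Finset.range l, (2 * χ i - ψ i) := by
    intro l
    induction l with
    | zero => simp
    | succ l ih =>
      intro hl
      by_cases h : c l < c (l + 1)
      · rw [Finset.sum_range_succ]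
        have h1 : χ l = 1 := if_pos h
        have h2 : ψ l ≤ 1 := by simp only [hψ]; split_ifs <;> norm_num
        have := ih (by omega)
        linarith
      · have hcl : c (l + 1) = c l := le_antisymm (not_lt.mp h) (hF.le_succ (by omega))
        have h1 : (C₁.filter (· < l + 1)).card ≤ (Finset.range (c l)).card := by
          refine card_le_card_of_charge hS.2 fun i hi => ?_
          rw [Finset.mem_filter] at hi
          exact exists_mem_lt_ptr hs hS (hrest l (by omega) hcl)
            (hdm i l (by omega) (by omega)) (hC₁ i hi.1).2
        rw [Finset.card_range] at h1
        have h2 := hχc (l + 1) hl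
        rw [Finset.sum_sub_distrib, ← Finset.mul_sum, hψsum]
        have h3 : ((C₁.filter (· < l + 1)).card : ℝ) ≤ c l := by exact_mod_cast h1
        rw [hcl] at h2
        linarith
  have habel := abel_le_sum (fun i => 2 * χ i - ψ i) d e
    (fun i hi => hdm i (i + 1) (by omega) (by omega)) (fun i hi => hw i (by omega))
  have hall : C₁.filter (· < e + 1) = C₁ :=
    Finset.filter_true_of_mem fun i hi => by have := (hC₁ i hi).1; omega
  have hdisj : Disjoint C₁ C₃ := Finset.disjoint_left.mpr fun i h1 h3 => by
    have := (hC₁ i h1).1; have := (hC₃ i h3).1; omega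
  have hcard : (C₁ ∪ C₃).card ≤ (Finset.range (c (e + 1))).card := by
    refine card_le_card_of_charge hS.2 fun i hi => ?_
    rcases Finset.mem_union.mp hi with h | h
    · rw [hce]
      exact exists_mem_lt_ptr hs hS (hrest e le_rfl hce) (hdm i e (hC₁ i h).1 he) (hC₁ i h).2
    · exact (hC₃ i h).2.2
  rw [Finset.card_union_of_disjoint hdisj, Finset.card_range] at hcard
  have hcard' : (C₁.card : ℝ) + C₃.card ≤ c (e + 1) := by exact_mod_cast hcard
  have hC₃sum : ∑ i ∈ C₃, d i ≤ C₃.card * d e := by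
    rw [← nsmul_eq_mul]
    exact Finset.sum_le_card_nsmul _ _ _ fun i hi =>
      hdm e i (hC₃ i hi).1.le (hC₃ i hi).2.1
  have hχd : ∑ i ∈ Finset.range (e + 1), χ i * d i =
      ∑ i ∈ Finset.range (e + 1) with c i < c (i + 1), d i := by
    rw [Finset.sum_filter]
    exact Finset.sum_congr rfl fun i _ => by simp only [hχ]; split_ifs <;> simp
  have hψd : ∑ i ∈ Finset.range (e + 1), ψ i * d i = ∑ i ∈ C₁, d i := by
    rw [← hall, Finset.sum_filter]
    simp only [hψ, ite_mul, one_mul, zero_mul]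
    rw [Finset.sum_ite_mem, ← Finset.sum_filter, hall]
    refine Finset.sum_congr ?_ fun _ _ => rfl
    ext x
    simp only [Finset.mem_inter, Finset.mem_range, and_iff_right_iff_imp]
    intro hx
    have := (hC₁ x hx).1; omega
  have hexp : ∑ i ∈ Finset.range (e + 1), (2 * χ i - ψ i) * d i =
      2 * ∑ i ∈ Finset.range (e + 1) with c i < c (i + 1), d i - ∑ i ∈ C₁, d i := by
    rw [← hχd, ← hψd, Finset.mul_sum, ← Finset.sum_sub_distrib]
    exact Finset.sum_congr rfl fun i _ => by ring
  rw [hexp, Finset.sum_sub_distrib, ← Finset.mul_sum, hψsum, hall] at habel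
  have h1 := hχc (e + 1) le_rfl
  have h2 : (C₃.card : ℝ) * d e ≤ (2 * ∑ i ∈ Finset.range (e + 1), χ i - C₁.card) * d e :=
    mul_le_mul_of_nonneg_right (by linarith) hde.le
  linarith

/-- The profit earned by bins up to an empty bin `e`, or by using items assigned before it,
when NFD assigns more than two items to one of the preceding bins. -/
theorem profit_le_of_three_le {e a : ℕ} {C₁ C₃ : Finset ℕ}
    (hd : ∀ i < m, 0 < d i) (hdm : ∀ i i', i ≤ i' → i' < m → d i' ≤ d i)
    (hs : ∀ j < n, 0 < s j) (hsm : ∀ j j', j ≤ j' → j' < n → s j' ≤ s j)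
    (hF : IsNFDRun d s m n c) (hc0 : c 0 = 0) (hS : IsSolution (Finset.range n) S)
    (he : e < m) (hce : c (e + 1) = c e) (hcn : c (e + 1) ≤ n)
    (hU : ∀ i ≤ e, ∑ j ∈ Finset.Ico (c i) (c (i + 1)), s j ≤ 2 * d i)
    (hC₁ : ∀ i ∈ C₁, i ≤ e ∧ d i ≤ ∑ j ∈ S i, s j)
    (hC₃ : ∀ i ∈ C₃, e < i ∧ i < m ∧ 2 * d i ≤ ∑ j ∈ S i, s j)
    (ha : a ≤ e) (hat : c a + 3 ≤ c (a + 1)) :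
    ∑ i ∈ C₁, d i + ∑ i ∈ C₃, d i ≤
      9 / 4 * ∑ i ∈ Finset.range (e + 1) with c i < c (i + 1), d i := by
  set A := (Finset.range (e + 1)).filter fun i => c i < c (i + 1) with hA
  have haA : a ∈ A := by simp [hA]; omega
  have hdA : ∀ i ∈ A, d e ≤ d i := fun i hi => by
    simp [hA] at hi; exact hdm i e (by omega) he
  have hde := hd e he
  have hrest : ∑ j ∈ Finset.Ico (c (e + 1)) n, s j < d e := by
    rcases hF e he with h' | h'
    · rw [hce]; exact h'.1
    · omega
  have hdisj : Disjoint C₁ C₃ := Finset.disjoint_left.mpr fun i h1 h3 => by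
    have := (hC₁ i h1).1; have := (hC₃ i h3).1; omega
  have hvol : ∑ i ∈ C₁, d i + 2 * ∑ i ∈ C₃, d i ≤ ∑ j ∈ Finset.range n, s j := by
    refine le_trans ?_ (sum_sum_le_of_isSolution (K := C₁ ∪ C₃) hS
      fun j hj => (hs j (Finset.mem_range.mp hj)).le)
    rw [Finset.sum_union hdisj, Finset.mul_sum]
    exact add_le_add (Finset.sum_le_sum fun i hi => (hC₁ i hi).2)
      (Finset.sum_le_sum fun i hi => (hC₃ i hi).2.2)
  have htot : ∑ j ∈ Finset.range n, s j =
      ∑ i ∈ A, ∑ j ∈ Finset.Ico (c i) (c (i + 1)), s j +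
        ∑ j ∈ Finset.Ico (c (e + 1)) n, s j := by
    have h1 := (sum_range_ptr s c 0 (e + 1) (by omega) fun i _ hi => hF.le_succ (by omega)).2
    rw [hc0, ← Finset.range_eq_Ico, ← Finset.range_eq_Ico] at h1
    rw [← Finset.sum_range_add_sum_Ico s hcn, h1, hA, Finset.sum_filter]
    congr 1
    refine Finset.sum_congr rfl fun i _ => ?_
    split_ifs with h
    · rfl
    · rw [Finset.Ico_eq_empty h]; simp
  have hUA : ∑ i ∈ A, ∑ j ∈ Finset.Ico (c i) (c (i + 1)), s j ≤
      2 * ∑ i ∈ A, d i - d a / 2 := by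
    rw [← Finset.add_sum_erase _ _ haA, ← Finset.add_sum_erase A d haA, mul_add, Finset.mul_sum]
    have h1 := hF.sum_le_of_three_le hs hsm (show a < m by omega) hat
    have h2 : ∑ i ∈ A.erase a, ∑ j ∈ Finset.Ico (c i) (c (i + 1)), s j ≤
        ∑ i ∈ A.erase a, 2 * d i := Finset.sum_le_sum fun i hi => by
      have := Finset.mem_of_mem_erase hi
      simp [hA] at this
      exact hU i (by omega)
    linarith
  have hdC₃ : 0 ≤ ∑ i ∈ C₃, d i := Finset.sum_nonneg fun i hi => (hd i (hC₃ i hi).2.1).le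
  have hdea := hdA a haA
  by_cases hone : ∃ b ∈ A, b ≠ a
  · obtain ⟨b, hb, hba⟩ := hone
    have h1 : d a + d b ≤ ∑ i ∈ A, d i := by
      rw [← Finset.sum_pair hba.symm]
      refine Finset.sum_le_sum_of_subset_of_nonneg ?_ fun i hi _ => hde.le.trans (hdA i hi)
      intro x hx
      rcases Finset.mem_insert.mp hx with rfl | hx
      · exact haA
      · rwa [Finset.mem_singleton.mp hx]
    have h2 := hdA b hb
    linarith
  · push Not at hone
    have hAa : A = {a} := Finset.eq_singleton_iff_unique_mem.mpr ⟨haA, hone⟩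
    rw [hAa, Finset.sum_singleton] at htot
    rw [hAa, Finset.sum_singleton, Finset.sum_singleton] at hUA
    rw [hAa, Finset.sum_singleton]
    have hzero : ∀ i ≤ a, c i = 0 := by
      intro i
      induction i with
      | zero => intro _; exact hc0
      | succ i ih =>
        intro hi
        by_contra hne
        have : i = a := hone i (by simp [hA, ih (by omega)]; omega)
        omega
    have hC₁a : ∀ i ∈ C₁, d i ≤ d a := by
      intro i hi
      refine hdm a i ?_ (by have := (hC₁ i hi).1; omega)
      by_contra! hia
      have hci : c (i + 1) = c i := by rw [hzero i hia.le, hzero (i + 1) hia]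
      have hri : ∑ j ∈ Finset.Ico (c i) n, s j < d i := by
        rcases hF i (by omega) with h' | h'
        · exact h'.1
        · omega
      obtain ⟨j, -, hj⟩ := exists_mem_lt_ptr hs hS hri le_rfl (hC₁ i hi).2
      rw [hzero i hia.le] at hj
      simp at hj
    by_cases hcard : C₁.card ≤ 2
    · have h1 : ∑ i ∈ C₁, d i ≤ C₁.card * d a := by
        rw [← nsmul_eq_mul]
        exact Finset.sum_le_card_nsmul _ _ _ hC₁a
      have h2 : (C₁.card : ℝ) * d a ≤ 2 * d a :=
        mul_le_mul_of_nonneg_right (by exact_mod_cast hcard) (hde.le.trans hdea)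
      linarith
    · have h1 : C₁.card * d e ≤ ∑ i ∈ C₁, d i := by
        rw [← nsmul_eq_mul]
        exact Finset.card_nsmul_le_sum _ _ _ fun i hi => hdm i e (hC₁ i hi).1 he
      have h2 : 3 * d e ≤ (C₁.card : ℝ) * d e :=
        mul_le_mul_of_nonneg_right (by exact_mod_cast not_le.mp hcard) hde.le
      linarith

/-- Comparison of an arbitrary solution with NFD, where `i₀` is preceded by an empty bin (if at
all), bins before `i₀` are filled to at most twice their demand, bins from `i₀` to `h` are
non-empty, and bin `h` is filled to more than twice its demand. -/
theorem profit_le_add_profit {i₀ h : ℕ}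
    (hd : ∀ i < m, 0 < d i) (hdm : ∀ i i', i ≤ i' → i' < m → d i' ≤ d i)
    (hs : ∀ j < n, 0 < s j) (hsm : ∀ j j', j ≤ j' → j' < n → s j' ≤ s j)
    (hF : IsNFDRun d s m n c) (hc0 : c 0 = 0) (hS : IsSolution (Finset.range n) S)
    (hi₀ : i₀ ≤ h) (hm : h < m) (hcn : c (h + 1) ≤ n)
    (hprev : ∀ e, i₀ = e + 1 → c (e + 1) = c e)
    (hU : ∀ i < i₀, ∑ j ∈ Finset.Ico (c i) (c (i + 1)), s j ≤ 2 * d i)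
    (hne : ∀ i, i₀ ≤ i → i ≤ h → c i < c (i + 1))
    (hhead : 2 * d h < ∑ j ∈ Finset.Ico (c h) (c (h + 1)), s j) :
    profit d d s (Finset.range m) S ≤
      9 / 4 * (∑ i ∈ Finset.range (h + 1) with c i < c (i + 1), d i) +
        profit d d s (Finset.Ico (h + 1) m) (fun i => S i ∩ Finset.Ico (c (h + 1)) n) := by
  have hitem : ∀ j < c (h + 1), 2 * d h < s j := by
    intro j hj
    rcases hF.eq_succ_or_lt hs hsm hm (hne h hi₀ le_rfl) with h1 | h1
    · rw [h1] at hhead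
      simp at hhead
      exact hhead.trans_le (hsm j (c h) (by omega) (by omega))
    · linarith
  have hcc := hF.mono (show i₀ ≤ h + 1 by omega) hm
  set C := (Finset.range m).filter fun i => d i ≤ ∑ j ∈ S i, s j with hC
  set C₁ := C.filter fun i => i < i₀ with hC₁
  set C₂ := C.filter fun i => i₀ ≤ i ∧ i ≤ h with hC₂
  set C₃ := C.filter fun i => h < i ∧ ∃ j ∈ S i, j ∈ Finset.range (c i₀) with hC₃
  set C₄ := C.filter fun i => h < i ∧ ∃ j ∈ S i, j ∈ Finset.Ico (c i₀) (c (h + 1)) with hC₄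
  set C₅ := C.filter fun i => h < i ∧ ∀ j ∈ S i, c (h + 1) ≤ j with hC₅
  have hdC : ∀ i ∈ C, 0 < d i := fun i hi => hd i (by simp [hC] at hi; exact hi.1)
  have hsplit : profit d d s (Finset.range m) S ≤
      ∑ i ∈ C₁, d i + ∑ i ∈ C₂, d i + ∑ i ∈ C₃, d i + ∑ i ∈ C₄, d i + ∑ i ∈ C₅, d i := by
    have hcover : C = C₁ ∪ (C₂ ∪ (C₃ ∪ (C₄ ∪ C₅))) := by
      ext i
      constructor
      · intro hi
        simp only [hC₁, hC₂, hC₃, hC₄, hC₅, Finset.mem_union, Finset.mem_filter]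
        by_cases h1 : i < i₀
        · exact Or.inl ⟨hi, h1⟩
        by_cases h2 : i ≤ h
        · exact Or.inr (Or.inl ⟨hi, not_lt.mp h1, h2⟩)
        by_cases h3 : ∃ j ∈ S i, j ∈ Finset.range (c i₀)
        · exact Or.inr (Or.inr (Or.inl ⟨hi, not_le.mp h2, h3⟩))
        by_cases h4 : ∃ j ∈ S i, j ∈ Finset.Ico (c i₀) (c (h + 1))
        · exact Or.inr (Or.inr (Or.inr (Or.inl ⟨hi, not_le.mp h2, h4⟩)))
        refine Or.inr (Or.inr (Or.inr (Or.inr ⟨hi, not_le.mp h2, fun j hj => ?_⟩)))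
        by_contra! hlt
        by_cases hj0 : j < c i₀
        · exact h3 ⟨j, hj, Finset.mem_range.mpr hj0⟩
        · exact h4 ⟨j, hj, Finset.mem_Ico.mpr ⟨not_lt.mp hj0, hlt⟩⟩
      · simp only [hC₁, hC₂, hC₃, hC₄, hC₅, Finset.mem_union, Finset.mem_filter]
        rintro (hi | hi | hi | hi | hi) <;> exact hi.1
    have nn : ∀ (p : ℕ → Prop) [DecidablePred p], ∀ i ∈ C.filter p, 0 ≤ d i :=
      fun p _ i hi => (hdC i (Finset.mem_filter.mp hi).1).le
    rw [profit, ← Finset.sum_filter, ← hC, hcover]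
    linarith [sum_union_le (B := C₂ ∪ (C₃ ∪ (C₄ ∪ C₅))) (nn fun i => i < i₀),
      sum_union_le (B := C₃ ∪ (C₄ ∪ C₅)) (nn fun i => i₀ ≤ i ∧ i ≤ h),
      sum_union_le (B := C₄ ∪ C₅)
        (nn fun i => h < i ∧ ∃ j ∈ S i, j ∈ Finset.range (c i₀)),
      sum_union_le (B := C₅)
        (nn fun i => h < i ∧ ∃ j ∈ S i, j ∈ Finset.Ico (c i₀) (c (h + 1)))]
  have hNFDsplit : ∑ i ∈ Finset.range (h + 1) with c i < c (i + 1), d i =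
      ∑ i ∈ Finset.range i₀ with c i < c (i + 1), d i + ∑ i ∈ Finset.Ico i₀ (h + 1), d i := by
    rw [Finset.sum_filter, Finset.sum_filter,
      ← Finset.sum_range_add_sum_Ico _ (show i₀ ≤ h + 1 by omega)]
    congr 1
    refine Finset.sum_congr rfl fun i hi => ?_
    rw [Finset.mem_Ico] at hi
    exact if_pos (hne i hi.1 (by omega))
  have hbound₂ : ∑ i ∈ C₂, d i ≤ ∑ i ∈ Finset.Ico i₀ (h + 1), d i := by
    refine Finset.sum_le_sum_of_subset_of_nonneg ?_ ?_
    · intro i hi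
      simp only [hC₂, Finset.mem_filter] at hi
      rw [Finset.mem_Ico]; omega
    · intro i hi _
      rw [Finset.mem_Ico] at hi
      exact (hd i (by omega)).le
  have hbound₄ : ∑ i ∈ C₄, d i ≤ ∑ i ∈ Finset.Ico i₀ (h + 1), d i := by
    have h1 : ∑ i ∈ C₄, d i ≤ ∑ j ∈ Finset.Ico (c i₀) (c (h + 1)), min (s j / 2) (d h) := by
      refine sum_le_sum_of_charge hS.2 ?_ ?_
      · intro j hj
        rw [Finset.mem_Ico] at hj
        have := hs j (by omega)
        have := hd h hm
        positivity
      · intro i hi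
        simp only [hC₄, hC, Finset.mem_filter, Finset.mem_range] at hi
        obtain ⟨⟨him, -⟩, hhi, j, hj, hjT⟩ := hi
        have h2 := hitem j (Finset.mem_Ico.mp hjT).2
        have h3 := hdm h i hhi.le him
        exact ⟨j, hj, hjT, le_min (by linarith) h3⟩
    refine h1.trans ?_
    rw [(sum_range_ptr (fun j => min (s j / 2) (d h)) c i₀ (h + 1) (by omega)
      fun i _ hi => hF.le_succ (by omega)).2]
    refine Finset.sum_le_sum fun i hi => ?_
    rw [Finset.mem_Ico] at hi
    rcases hF.eq_succ_or_lt hs hsm (show i < m by omega) (hne i hi.1 (by omega)) with h2 | h2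
    · rw [h2]
      simp only [Nat.Ico_succ_singleton, Finset.sum_singleton]
      exact (min_le_right _ _).trans (hdm i h (by omega) hm)
    · calc ∑ j ∈ Finset.Ico (c i) (c (i + 1)), min (s j / 2) (d h)
          ≤ ∑ j ∈ Finset.Ico (c i) (c (i + 1)), s j / 2 :=
            Finset.sum_le_sum fun j _ => min_le_left _ _
        _ = (∑ j ∈ Finset.Ico (c i) (c (i + 1)), s j) / 2 := by rw [Finset.sum_div]
        _ ≤ d i := by linarith
  have hbound₅ : ∑ i ∈ C₅, d i ≤
      profit d d s (Finset.Ico (h + 1) m) (fun i => S i ∩ Finset.Ico (c (h + 1)) n) := by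
    rw [profit, ← Finset.sum_filter]
    refine Finset.sum_le_sum_of_subset_of_nonneg ?_ ?_
    · intro i hi
      simp only [hC₅, hC, Finset.mem_filter, Finset.mem_range] at hi
      obtain ⟨⟨him, hcov⟩, hhi, hall⟩ := hi
      have : S i ∩ Finset.Ico (c (h + 1)) n = S i := by
        rw [Finset.inter_eq_left]
        intro j hj
        exact Finset.mem_Ico.mpr ⟨hall j hj, Finset.mem_range.mp (hS.1 i hj)⟩
      simp only [Finset.mem_filter, Finset.mem_Ico, this]
      exact ⟨⟨hhi, him⟩, hcov⟩
    · intro i hi _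
      simp only [Finset.mem_filter, Finset.mem_Ico] at hi
      exact (hd i hi.1.2).le
  have hR : 0 ≤ ∑ i ∈ Finset.Ico i₀ (h + 1), d i := Finset.sum_nonneg fun i hi => by
    rw [Finset.mem_Ico] at hi
    exact (hd i (by omega)).le
  have hmem₁ : ∀ i ∈ C₁, i < i₀ ∧ d i ≤ ∑ j ∈ S i, s j := by
    intro i hi
    simp only [hC₁, hC, Finset.mem_filter] at hi
    exact ⟨hi.2, hi.1.2⟩
  have hmem₃ : ∀ i ∈ C₃, h < i ∧ i < m ∧ ∃ j ∈ S i, j ∈ Finset.range (c i₀) := by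
    intro i hi
    simp only [hC₃, hC, Finset.mem_filter, Finset.mem_range] at hi
    simp only [Finset.mem_range]
    exact ⟨hi.2.1, hi.1.1, hi.2.2⟩
  have hbound₁₃ : ∑ i ∈ C₁, d i + ∑ i ∈ C₃, d i ≤
      9 / 4 * ∑ i ∈ Finset.range i₀ with c i < c (i + 1), d i := by
    rcases Nat.eq_zero_or_eq_succ_pred i₀ with h0 | h0
    · have e1 : C₁ = ∅ := Finset.eq_empty_of_forall_notMem fun i hi => by
        have := (hmem₁ i hi).1; omega
      have e3 : C₃ = ∅ := Finset.eq_empty_of_forall_notMem fun i hi => by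
        obtain ⟨-, -, j, -, hj⟩ := hmem₃ i hi
        rw [h0, hc0] at hj
        simp at hj
      rw [e1, e3, h0]
      simp
    · obtain ⟨e, rfl⟩ : ∃ e, i₀ = e + 1 := ⟨_, h0⟩
      have hce := hprev e rfl
      by_cases ht : ∀ i ≤ e, c (i + 1) ≤ c i + 2
      · have h1 := profit_le_of_le_two hdm hs hF hc0 hS (show e < m by omega) hce
          (fun i hi => ⟨by have := (hmem₁ i hi).1; omega, (hmem₁ i hi).2⟩)
          (fun i hi => ⟨by have := (hmem₃ i hi).1; omega, (hmem₃ i hi).2⟩) ht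
          (hd e (by omega))
        have h2 : 0 ≤ ∑ i ∈ Finset.range (e + 1) with c i < c (i + 1), d i :=
          Finset.sum_nonneg fun i hi => by
            simp only [Finset.mem_filter, Finset.mem_range] at hi
            exact (hd i (by omega)).le
        linarith
      · push Not at ht
        obtain ⟨a, ha, hat⟩ := ht
        refine profit_le_of_three_le hd hdm hs hsm hF hc0 hS (show e < m by omega) hce
          (by omega) (fun i hi => hU i (by omega))
          (fun i hi => ⟨by have := (hmem₁ i hi).1; omega, (hmem₁ i hi).2⟩) ?_ ha (by omega)
        intro i hi
        obtain ⟨h1, h2, j, hj, hjT⟩ := hmem₃ i hi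
        refine ⟨by omega, h2, ?_⟩
        rw [Finset.mem_range] at hjT
        have h3 := hitem j (by omega)
        have h4 := hdm h i h1.le h2
        have h5 : s j ≤ ∑ j ∈ S i, s j := Finset.single_le_sum (f := s)
          (fun j hj => (hs j (Finset.mem_range.mp (hS.1 i hj))).le) hj
        linarith
  rw [hNFDsplit]
  linarith

end Core

theorem profit_le_OPT {d s : ℕ → ℝ} {B T : Finset ℕ} {S : ℕ → Finset ℕ}
    (hd : ∀ i ∈ B, 0 ≤ d i) (hS : IsSolution T S) : profit d d s B S ≤ OPT d d s B T := by
  refine le_csSup ⟨∑ i ∈ B, d i, ?_⟩ ⟨S, hS, rfl⟩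
  rintro _ ⟨S', -, rfl⟩
  refine Finset.sum_le_sum fun i hi => ?_
  split_ifs
  · exact le_rfl
  · exact hd i hi

theorem isNFDRun_nfdPtr {d : ℕ → ℝ} (s : ℕ → ℝ) {m : ℕ} (n : ℕ) (hd : ∀ i < m, 0 < d i) :
    IsNFDRun d s m n (nfdPtr d s n) := fun i hi =>
  nfdPtr_step d s n i (hd i hi) (nfdPtr_le d s n m hd i hi.le)

theorem IsNFDRun.covered_iff {d s : ℕ → ℝ} {m n : ℕ} {c : ℕ → ℕ} (hF : IsNFDRun d s m n c)
    {i : ℕ} (hi : i < m) (hdi : 0 < d i) :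
    d i ≤ ∑ j ∈ Finset.Ico (c i) (c (i + 1)), s j ↔ c i < c (i + 1) := by
  rcases hF i hi with h | h
  · simp [h.2, hdi]
  · simp [h.1, h.2.2.1]

theorem NFD_Ico (d s : ℕ → ℝ) (m n b : ℕ) (hbm : b ≤ m) (hd : ∀ i < m, 0 < d i) :
    NFD d s (Finset.Ico b m) (Finset.Ico (nfdPtr d s n b) n) =
      ∑ i ∈ Finset.Ico b m, if nfdPtr d s n i < nfdPtr d s n (i + 1) then d i else 0 := by
  rw [NFD, profit]
  refine Finset.sum_congr rfl fun i hi => ?_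
  rw [Finset.mem_Ico] at hi
  rw [nfdSol_Ico d s m n b i hbm hi.1, if_pos hi.2]
  exact if_congr ((isNFDRun_nfdPtr s n hd).covered_iff hi.2 (hd i hi.2)) rfl rfl

theorem nfdU_range (d s : ℕ → ℝ) (m n i : ℕ) (hi : i < m) :
    nfdU d s (Finset.range m) (Finset.range n) i =
      ∑ j ∈ Finset.Ico (nfdPtr d s n i) (nfdPtr d s n (i + 1)), s j := by
  rw [nfdU, nfdSol_range, if_pos hi]

theorem nfdU_range_eq_zero (d s : ℕ → ℝ) (m n i : ℕ) (hi : m ≤ i) :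
    nfdU d s (Finset.range m) (Finset.range n) i = 0 := by
  rw [nfdU, nfdSol_range, if_neg (by omega), Finset.sum_empty]

theorem biUnion_nfdSol_range (d s : ℕ → ℝ) (m n b : ℕ) (hbm : b ≤ m) (hd : ∀ i < m, 0 < d i) :
    (Finset.range b).biUnion (nfdSol d s (Finset.range m) (Finset.range n)) =
      Finset.range (nfdPtr d s n b) := by
  induction b with
  | zero => simp [nfdPtr]
  | succ b ih =>
    rw [Finset.range_add_one, Finset.biUnion_insert, ih (by omega), nfdSol_range,
      if_pos (by omega)]
    have := (isNFDRun_nfdPtr s n hd).le_succ (show b < m by omega)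
    ext x
    simp only [Finset.mem_union, Finset.mem_Ico, Finset.mem_range]
    omega

/-- The structure of the bins up to the head of an instance. -/
theorem IsHead.exists_start {d s : ℕ → ℝ} {m n h : ℕ} (hd : ∀ i < m, 0 < d i)
    (hhead : IsHead d s m (Finset.range n) h) :
    ∃ i₀ ≤ h, h < m ∧
      (∀ e, i₀ = e + 1 → nfdU d s (Finset.range m) (Finset.range n) e ≤ 0) ∧
      (∀ i < i₀, nfdU d s (Finset.range m) (Finset.range n) i ≤ 2 * d i) ∧
      (∀ i, i₀ ≤ i → i ≤ h → nfdU d s (Finset.range m) (Finset.range n) i ≠ 0) ∧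
      2 * d h < nfdU d s (Finset.range m) (Finset.range n) h := by
  obtain ⟨i₀, i₁, hi₀, hpos, hnw, hmin, hle, -, hne, hh, hbig, -⟩ := hhead
  have hi₁ : i₁ < m := by
    by_contra! hcon
    refine hne (m - 1) (by omega) (by omega) ?_
    exact nfdU_range_eq_zero d s m n _ (by omega)
  have hsmall : ∀ i < i₀, nfdU d s (Finset.range m) (Finset.range n) i ≤ 2 * d i := by
    intro i hi
    by_cases h0 : 0 < nfdU d s (Finset.range m) (Finset.range n) i
    · obtain ⟨-, -, i', hi', -, -, -, hall⟩ := hmin i hi h0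
      exact hall i hi'.le
    · have := hd i (by omega)
      linarith
  refine ⟨i₀, ?_, by omega, ?_, hsmall, ?_, hbig⟩
  · by_contra! hlt
    exact absurd (hsmall h hlt) (not_le.mpr hbig)
  · rintro e rfl
    by_contra! h0
    obtain ⟨-, -, i', hei', hi'm, hzero, hbetween, hall⟩ := hmin e (by omega) h0
    have hne' : i' ≠ e + 1 := by
      rintro rfl
      exact hpos.ne' hzero
    exact hnw ⟨hi₀, hpos, i', by omega, hi'm, hzero,
      fun i hi hi' => hbetween i (by omega) hi', hall⟩
  · intro i hi hih
    rcases Nat.eq_or_lt_of_le hi with rfl | hlt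
    · exact hpos.ne'
    · have := hne (i - 1) (by omega) (by omega)
      rwa [Nat.sub_add_cancel (by omega)] at this

/- STATEMENT 17 -/
theorem stmt17 (m n : ℕ) (d s : ℕ → ℝ)
    (hd : ∀ i < m, 0 < d i) (hdm : ∀ i i', i ≤ i' → i' < m → d i' ≤ d i)
    (hs : ∀ j < n, 0 < s j) (hsm : ∀ j j', j ≤ j' → j' < n → s j' ≤ s j)
    (istar : ℕ) (hhead : IsHead d s m (Finset.range n) istar)
    (hNFD : 0 < NFD d s (Finset.range m) (Finset.range n))
    (hNFD'' : 0 < NFD d s (Finset.range m \ Finset.range (istar + 1))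
      (Finset.range n \ (Finset.range (istar + 1)).biUnion
        (nfdSol d s (Finset.range m) (Finset.range n)))) :
    OPT d d s (Finset.range m) (Finset.range n) / NFD d s (Finset.range m) (Finset.range n) ≤
      max (9 / 4)
        (OPT d d s (Finset.range m \ Finset.range (istar + 1))
            (Finset.range n \ (Finset.range (istar + 1)).biUnion
              (nfdSol d s (Finset.range m) (Finset.range n))) /
          NFD d s (Finset.range m \ Finset.range (istar + 1))
            (Finset.range n \ (Finset.range (istar + 1)).biUnion
              (nfdSol d s (Finset.range m) (Finset.range n)))) := by
  obtain ⟨i₀, hi₀, hm, hprev, hU, hne, hbig⟩ := hhead.exists_start hd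
  have hF := isNFDRun_nfdPtr s n hd
  have hI : Finset.range m \ Finset.range (istar + 1) = Finset.Ico (istar + 1) m := by
    ext x; simp; omega
  have hJ : Finset.range n \ (Finset.range (istar + 1)).biUnion
      (nfdSol d s (Finset.range m) (Finset.range n)) =
      Finset.Ico (nfdPtr d s n (istar + 1)) n := by
    rw [biUnion_nfdSol_range d s m n (istar + 1) hm hd]
    ext x; simp; omega
  rw [hI, hJ] at hNFD'' ⊢
  set c := nfdPtr d s n with hc
  have hNFDsplit : NFD d s (Finset.range m) (Finset.range n) =
      ∑ i ∈ Finset.range (istar + 1) with c i < c (i + 1), d i +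
        NFD d s (Finset.Ico (istar + 1) m) (Finset.Ico (c (istar + 1)) n) := by
    have h0 := NFD_Ico d s m n 0 (Nat.zero_le m) hd
    rw [show nfdPtr d s n 0 = 0 from rfl, ← Finset.range_eq_Ico, ← Finset.range_eq_Ico] at h0
    rw [h0, NFD_Ico d s m n (istar + 1) hm hd, Finset.sum_filter,
      Finset.sum_range_add_sum_Ico _ (show istar + 1 ≤ m from hm)]
  have hempty : ∀ e < m, nfdU d s (Finset.range m) (Finset.range n) e ≤ 0 →
      c (e + 1) = c e := by
    intro e he h
    rw [nfdU_range d s m n e he] at h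
    have hde := hd e he
    have := mt (hF.covered_iff he hde).mpr (not_le.mpr (h.trans_lt hde))
    exact le_antisymm (not_lt.mp this) (hF.le_succ he)
  have hOPT : OPT d d s (Finset.range m) (Finset.range n) ≤
      9 / 4 * (∑ i ∈ Finset.range (istar + 1) with c i < c (i + 1), d i) +
        OPT d d s (Finset.Ico (istar + 1) m) (Finset.Ico (c (istar + 1)) n) := by
    refine csSup_le ⟨_, fun _ => ∅, ⟨fun _ => Finset.empty_subset _,
      fun _ _ _ => Finset.disjoint_empty_left _⟩, rfl⟩ ?_
    rintro _ ⟨S, hS, rfl⟩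
    refine (profit_le_add_profit hd hdm hs hsm hF rfl hS hi₀ hm
      (nfdPtr_le d s n m hd _ hm) ?_ ?_ ?_ ?_).trans (add_le_add_right (profit_le_OPT ?_ ?_) _)
    · intro e he
      exact hempty e (by omega) (hprev e he)
    · intro i hi
      rw [← nfdU_range d s m n i (by omega)]
      exact hU i hi
    · intro i hi hih
      refine lt_of_le_of_ne (hF.le_succ (by omega)) fun heq => hne i hi hih ?_
      rw [nfdU_range d s m n i (by omega), ← hc, ← heq]
      simp
    · rwa [← nfdU_range d s m n istar hm]
    · intro i hi
      exact (hd i (Finset.mem_Ico.mp hi).2).le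
    · exact ⟨fun i => Finset.inter_subset_right,
        fun i i' hii => (hS.2 hii).mono Finset.inter_subset_left Finset.inter_subset_left⟩
  set D := ∑ i ∈ Finset.range (istar + 1) with c i < c (i + 1), d i
  have hD0 : 0 ≤ D := Finset.sum_nonneg fun i hi => by
    simp only [Finset.mem_filter, Finset.mem_range] at hi
    exact (hd i (by omega)).le
  set O := OPT d d s (Finset.Ico (istar + 1) m) (Finset.Ico (c (istar + 1)) n)
  set N := NFD d s (Finset.Ico (istar + 1) m) (Finset.Ico (c (istar + 1)) n)
  rw [div_le_iff₀ hNFD, hNFDsplit, mul_add]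
  have h1 : 9 / 4 * D ≤ max (9 / 4) (O / N) * D :=
    mul_le_mul_of_nonneg_right (le_max_left _ _) hD0
  have h2 : O ≤ max (9 / 4) (O / N) * N := by
    rw [← div_le_iff₀ hNFD'']
    exact le_max_right _ _
  linarith

end BinCov
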